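/- arXiv:math/0501328 — 2 statements merged into one kernel-verified Lean document; each statement's English description precedes it below -/
import Mathlib

section
/- Suppose f = ĝ is the Fourier transform of a nontrivial function g ∈ L¹(ℝ) whose support is contained in an interval of length at most 2π. Then the linear span of the integer translates f(· − n), n ∈ ℤ, is dense in C(ℝ) in the topology of uniform convergence on compact subsets of ℝ. -/
open MeasureTheory Set Filter Topology in
lemma ITD.fourier_unique (a : ℝ) (h : ℝ → ℂ) (hh : Integrable h)
    (hs : ∀ x, x ∉ Icc a (a + 2 * Real.pi) → h x = 0)
    (hz : ∀ n : ℤ, ∫ t : ℝ, h t * Complex.exp (Complex.I * n * t) = 0) :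
    ∀ᵐ x : ℝ, h x = 0 := by
  haveI : Fact (0 < 2 * Real.pi) := ⟨Real.two_pi_pos⟩
  -- all continuous periodic test functions
  have hint : ∀ φ : C(AddCircle (2 * Real.pi), ℂ),
      Integrable (fun t : ℝ => h t * φ (t : AddCircle (2 * Real.pi))) := by
    intro φ
    refine hh.mul_bdd (c := ‖φ‖) ?_ ?_
    · exact (φ.continuous.comp (AddCircle.continuous_mk' _)).aestronglyMeasurable
    · exact Eventually.of_forall fun t => φ.norm_coe_le_norm _
  let Λ : C(AddCircle (2 * Real.pi), ℂ) →L[ℂ] ℂ := LinearMap.mkContinuous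
    { toFun := fun φ => ∫ t : ℝ, h t * φ (t : AddCircle (2 * Real.pi))
      map_add' := by
        intro φ ψ
        rw [← integral_add (hint φ) (hint ψ)]
        congr 1; ext t; simp [mul_add]
      map_smul' := by
        intro c φ
        simp only [RingHom.id_apply, smul_eq_mul]
        rw [← integral_const_mul]
        congr 1; ext t; simp; ring } (∫ t, ‖h t‖) (by
      intro φ
      simp only [LinearMap.coe_mk, AddHom.coe_mk]
      rw [← integral_mul_const]
      refine norm_integral_le_of_norm_le (hh.norm.mul_const _) (Eventually.of_forall fun t => ?_)
      rw [norm_mul]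
      gcongr
      exact φ.norm_coe_le_norm _)
  have hΛ : ∀ φ, Λ φ = ∫ t : ℝ, h t * φ (t : AddCircle (2 * Real.pi)) := fun φ => rfl
  have hker : ∀ φ, Λ φ = 0 := by
    have h1 : (Submodule.span ℂ (range (@fourier (2 * Real.pi)))).topologicalClosure
        ≤ LinearMap.ker (Λ : C(AddCircle (2 * Real.pi), ℂ) →ₗ[ℂ] ℂ) := by
      apply Submodule.topologicalClosure_minimal
      · rw [Submodule.span_le]
        rintro _ ⟨n, rfl⟩
        show Λ _ = 0
        rw [hΛ, ← hz n]
        congr 1; ext t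
        rw [fourier_coe_apply]
        congr 2
        have : (Real.pi : ℂ) ≠ 0 := by exact_mod_cast Real.pi_ne_zero
        push_cast
        field_simp
      · exact Λ.isClosed_ker
    rw [span_fourier_closure_eq_top] at h1
    intro φ
    exact h1 (Submodule.mem_top : φ ∈ ⊤)
  have hmain : ∀ᵐ x : ℝ, x ∈ Ioo a (a + 2 * Real.pi) → h x = 0 := by
    refine isOpen_Ioo.ae_eq_zero_of_integral_contDiff_smul_eq_zero
      (hh.locallyIntegrable.locallyIntegrableOn _) ?_
    intro φ hφ _ hsub
    have hφ0 : ∀ x, x ∉ Ioo a (a + 2 * Real.pi) → φ x = 0 := fun x hx =>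
      image_eq_zero_of_notMem_tsupport fun h' => hx (hsub h')
    let ψ : C(AddCircle (2 * Real.pi), ℂ) :=
      ⟨AddCircle.liftIco (2 * Real.pi) a (fun x => (φ x : ℂ)),
        AddCircle.liftIco_continuous
          (by simp [hφ0 a (by simp), hφ0 (a + 2 * Real.pi) (by simp)])
          (Complex.continuous_ofReal.comp hφ.continuous).continuousOn⟩
    rw [← hker ψ, hΛ]
    apply integral_congr_ae
    have : ∀ᵐ x : ℝ, x ≠ a + 2 * Real.pi := by simp [ae_iff, measure_singleton]
    filter_upwards [this] with x hx
    by_cases hx' : x ∈ Icc a (a + 2 * Real.pi)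
    · have : ψ (x : AddCircle (2 * Real.pi)) = φ x :=
        AddCircle.liftIco_coe_apply (f := fun x => (φ x : ℂ)) ⟨hx'.1, lt_of_le_of_ne hx'.2 hx⟩
      rw [this, Complex.real_smul, mul_comm]
    · simp [hs x hx']
  have h2 : ∀ᵐ x : ℝ, x ≠ a + 2 * Real.pi := by simp [ae_iff, measure_singleton]
  have h3 : ∀ᵐ x : ℝ, x ≠ a := by simp [ae_iff, measure_singleton]
  filter_upwards [hmain, h2, h3] with x h1 h2 h3
  by_cases hx' : x ∈ Icc a (a + 2 * Real.pi)
  · exact h1 ⟨lt_of_le_of_ne hx'.1 (Ne.symm h3), lt_of_le_of_ne hx'.2 h2⟩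
  · exact hs x hx'

/-- the function `x ↦ -i x` on `K` -/
noncomputable def ITD.a (K : Set ℝ) : C(K, ℂ) := ⟨fun x => -Complex.I * (x : ℝ), by fun_prop⟩

/-- the exponential `x ↦ exp (-i x t)` on `K` -/
noncomputable def ITD.e (K : Set ℝ) (t : ℝ) : C(K, ℂ) :=
  ⟨fun x => Complex.exp (-Complex.I * (x : ℝ) * t), by fun_prop⟩

lemma ITD.e_eq (K : Set ℝ) [CompactSpace K] (t : ℝ) :
    ITD.e K t = NormedSpace.exp (t • ITD.a K) := by
  ext x
  have h := NormedSpace.map_exp (ContinuousMap.evalAlgHom ℂ ℂ x)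
    (show Continuous fun q : C(K, ℂ) => q x from continuous_eval_const x) (t • ITD.a K)
  have h' : (NormedSpace.exp (t • ITD.a K) : C(K, ℂ)) x = NormedSpace.exp ((t • ITD.a K) x) := h
  rw [h', ← Complex.exp_eq_exp_ℂ]
  simp [ITD.e, ITD.a]
  ring_nf

lemma ITD.e_analytic (K : Set ℝ) [CompactSpace K] (t : ℝ) : AnalyticAt ℝ (ITD.e K) t := by
  have : ITD.e K = fun t : ℝ => NormedSpace.exp (t • ITD.a K) := funext (ITD.e_eq K)
  rw [this]
  exact (NormedSpace.exp_analytic (𝕂 := ℝ) _).fun_comp (analyticAt_id.smul analyticAt_const)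

lemma ITD.e_norm (K : Set ℝ) [CompactSpace K] (t : ℝ) : ‖ITD.e K t‖ ≤ 1 := by
  rw [ContinuousMap.norm_le _ zero_le_one]
  intro x
  have : -Complex.I * ((x : ℝ) : ℂ) * t = ((-(x * t) : ℝ) : ℂ) * Complex.I := by push_cast; ring
  show ‖Complex.exp _‖ ≤ 1
  rw [this, Complex.norm_exp_ofReal_mul_I]

lemma ITD.eq_zero_of_e (K : Set ℝ) [CompactSpace K] (L : C(K, ℂ) →L[ℂ] ℂ)
    (hL : ∀ t, L (ITD.e K t) = 0) : L = 0 := by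
  have hmul : ∀ s t, ITD.e K s * ITD.e K t = ITD.e K (s + t) := by
    intro s t; ext x; simp [ITD.e, ← Complex.exp_add, mul_add]
  have hstar : ∀ t, star (ITD.e K t) = ITD.e K (-t) := by
    intro t; ext x; simp [ITD.e, ← Complex.exp_conj]
  have hone : ITD.e K 0 = 1 := by ext x; simp [ITD.e]
  let S := Submodule.span ℂ (Set.range (ITD.e K))
  have h1S : (1 : C(K, ℂ)) ∈ S := hone ▸ Submodule.subset_span ⟨0, rfl⟩
  let A : StarSubalgebra ℂ C(K, ℂ) :=
    { carrier := S
      mul_mem' := by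
        intro p q hp hq
        have := Submodule.mul_mem_mul hp hq
        rw [Submodule.span_mul_span] at this
        refine Submodule.span_mono ?_ this
        rintro _ ⟨_, ⟨s, rfl⟩, _, ⟨t, rfl⟩, rfl⟩
        exact ⟨s + t, (hmul s t).symm⟩
      add_mem' := S.add_mem
      algebraMap_mem' := by
        intro r
        rw [Algebra.algebraMap_eq_smul_one]
        exact S.smul_mem _ h1S
      star_mem' := by
        intro p hp
        induction hp using Submodule.span_induction with
        | mem x hx =>
          obtain ⟨t, rfl⟩ := hx
          rw [hstar]; exact Submodule.subset_span ⟨_, rfl⟩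
        | zero => rw [star_zero]; exact S.zero_mem
        | add x y _ _ hx hy => rw [star_add]; exact S.add_mem hx hy
        | smul c x _ hx => rw [star_smul]; exact S.smul_mem _ hx }
  have hA : A.SeparatesPoints := by
    intro x y hxy
    have hne : (x : ℝ) - y ≠ 0 := sub_ne_zero.2 fun h => hxy (Subtype.ext h)
    refine ⟨_, ⟨ITD.e K (Real.pi / (x - y)), Submodule.subset_span ⟨_, rfl⟩, rfl⟩, ?_⟩
    intro h
    have h2 : Complex.exp (-Complex.I * (x : ℝ) * (Real.pi / (x - y) : ℝ))
        = Complex.exp (-Complex.I * (y : ℝ) * (Real.pi / (x - y) : ℝ)) := h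
    have h3 : -Complex.I * (x : ℝ) * (Real.pi / (x - y) : ℝ)
        = -Complex.I * (y : ℝ) * (Real.pi / (x - y) : ℝ) - Real.pi * Complex.I := by
      have : ((x : ℝ) : ℂ) - ((y : ℝ) : ℂ) ≠ 0 := by exact_mod_cast hne
      push_cast
      field_simp
      ring
    rw [h3, Complex.exp_sub, Complex.exp_pi_mul_I] at h2
    have := Complex.exp_ne_zero (-Complex.I * (y : ℝ) * (Real.pi / (x - y) : ℝ))
    apply this
    linear_combination (-1/2) * h2
  have hA' := ContinuousMap.starSubalgebra_topologicalClosure_eq_top_of_separatesPoints A hA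
  have hdense : ∀ p : C(K, ℂ), p ∈ closure (S : Set C(K, ℂ)) := by
    intro p
    have : p ∈ A.topologicalClosure := hA' ▸ StarSubalgebra.mem_top
    exact this
  have hle : (S : Set C(K, ℂ)) ⊆ LinearMap.ker (L : C(K, ℂ) →ₗ[ℂ] ℂ) := by
    rw [SetLike.coe_subset_coe, Submodule.span_le]
    rintro _ ⟨t, rfl⟩
    exact hL t
  ext p
  exact closure_minimal hle L.isClosed_ker (hdense p)

lemma ITD.hahn_banach {E : Type*} [NormedAddCommGroup E] [NormedSpace ℂ E] (S : Submodule ℂ E)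
    (h : ∀ L : E →L[ℂ] ℂ, (∀ x ∈ S, L x = 0) → L = 0) (x : E) : x ∈ closure (S : Set E) := by
  letI : NormedSpace ℝ E := NormedSpace.restrictScalars ℝ ℂ E
  by_contra hx
  have hc : Convex ℝ (closure (S : Set E)) := by
    have : Convex ℝ ((S.restrictScalars ℝ : Submodule ℝ E) : Set E) := Submodule.convex _
    exact this.closure
  obtain ⟨L, u, h1, h2⟩ := RCLike.geometric_hahn_banach_closed_point (𝕜 := ℂ) hc
    isClosed_closure hx
  have hu : 0 < u := by simpa using h1 0 (subset_closure S.zero_mem)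
  have hL : L = 0 := by
    apply h
    intro y hy
    by_contra hy0
    have := h1 (((u : ℂ) / L y) • y) (subset_closure (S.smul_mem _ hy))
    rw [map_smul, smul_eq_mul, div_mul_cancel₀ _ hy0] at this
    simp at this
  rw [hL] at h2
  simp at h2
  linarith

open MeasureTheory Filter Topology in
lemma ITD.compact_case (g : ℝ → ℂ)
    (hg : Integrable g) (hg0 : ¬ (∀ᵐ x : ℝ ∂volume, g x = 0))
    (a : ℝ) (hsupp : ∀ x : ℝ, x ∉ Set.Icc a (a + 2 * Real.pi) → g x = 0)
    (f : ℝ → ℂ)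
    (hf : ∀ x : ℝ, f x =
      (1 / (2 * Real.pi) : ℂ) * ∫ t : ℝ, g t * Complex.exp (-Complex.I * x * t))
    (K : Set ℝ) [CompactSpace K] (L : C(K, ℂ) →L[ℂ] ℂ)
    (hL : ∀ n : ℤ, ∀ p : C(K, ℂ), (∀ x : K, p x = f (x - n)) → L p = 0) : L = 0 := by
  have hcont : Continuous (ITD.e K) :=
    continuous_iff_continuousAt.2 fun t => (ITD.e_analytic K t).continuousAt
  have hgn : ∀ n : ℤ, Integrable (fun t : ℝ => g t * Complex.exp (Complex.I * n * t)) := by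
    intro n
    refine hg.mul_bdd (c := 1) (by fun_prop) (Eventually.of_forall fun t => ?_)
    have : Complex.I * n * t = ((n * t : ℝ) : ℂ) * Complex.I := by push_cast; ring
    rw [this, Complex.norm_exp_ofReal_mul_I]
  have hint : ∀ n : ℤ, Integrable
      (fun t : ℝ => (g t * Complex.exp (Complex.I * n * t)) • ITD.e K t) := by
    intro n
    exact (hgn n).smul_bdd 1 hcont.aestronglyMeasurable
      (Eventually.of_forall fun t => ITD.e_norm K t)
  have hz : ∀ n : ℤ, ∫ t : ℝ, (g t * L (ITD.e K t)) * Complex.exp (Complex.I * n * t) = 0 := by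
    intro n
    have h1 : L (∫ t : ℝ, (g t * Complex.exp (Complex.I * n * t)) • ITD.e K t)
        = ∫ t : ℝ, (g t * L (ITD.e K t)) * Complex.exp (Complex.I * n * t) := by
      rw [← L.integral_comp_comm (hint n)]
      congr 1; ext t; simp; ring
    have h2 : L ((1 / (2 * Real.pi) : ℂ) •
        ∫ t : ℝ, (g t * Complex.exp (Complex.I * n * t)) • ITD.e K t) = 0 := by
      apply hL n
      intro x
      rw [hf]
      have h3 := (ContinuousMap.evalCLM ℂ x : C(K, ℂ) →L[ℂ] ℂ).integral_comp_comm (hint n)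
      simp only [ContinuousMap.evalCLM_apply] at h3
      rw [ContinuousMap.smul_apply, ← h3, smul_eq_mul]
      congr 2; ext t
      simp only [ContinuousMap.smul_apply, smul_eq_mul, ITD.e, ContinuousMap.coe_mk, mul_assoc]
      rw [← Complex.exp_add]
      congr 2
      push_cast; ring
    rw [map_smul, h1, smul_eq_mul] at h2
    refine (mul_eq_zero.1 h2).resolve_left ?_
    have : (Real.pi : ℂ) ≠ 0 := by exact_mod_cast Real.pi_ne_zero
    simp [this]
  have hGint : Integrable (fun t : ℝ => g t * L (ITD.e K t)) := by
    refine hg.mul_bdd (c := ‖L‖) (L.continuous.comp hcont).aestronglyMeasurable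
      (Eventually.of_forall fun t => ?_)
    exact (L.le_opNorm _).trans (mul_le_of_le_one_right (norm_nonneg _) (ITD.e_norm K t))
  have hae := ITD.fourier_unique a _ hGint (fun x hx => by simp [hsupp x hx]) hz
  apply ITD.eq_zero_of_e
  by_contra! hne
  obtain ⟨t₀, ht₀⟩ := hne
  apply hg0
  have han : AnalyticOnNhd ℝ (fun t : ℝ => L (ITD.e K t)) Set.univ := fun t _ =>
    ((L.restrictScalars ℝ).analyticAt _).fun_comp (ITD.e_analytic K t)
  have hcod := han.preimage_zero_mem_codiscrete ht₀
  have hae2 : ∀ᵐ t : ℝ, L (ITD.e K t) ≠ 0 := by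
    have := ae_restrict_le_codiscreteWithin (μ := (volume : Measure ℝ)) MeasurableSet.univ
    rw [Measure.restrict_univ] at this
    exact this hcod
  filter_upwards [hae, hae2] with t h1 h2
  exact (mul_eq_zero.1 h1).resolve_right h2

/-- If f is the Fourier transform of a nontrivial g ∈ L¹(ℝ) supported in an interval of
length at most 2π, then the span of the integer translates of f is dense in C(ℝ)
in the topology of uniform convergence on compacta (the compact-open topology). -/
theorem integer_translates_dense (g : ℝ → ℂ)
    (hg : MeasureTheory.Integrable g)
    (hg0 : ¬ (∀ᵐ x : ℝ ∂MeasureTheory.volume, g x = 0))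
    (a : ℝ) (hsupp : ∀ x : ℝ, x ∉ Set.Icc a (a + 2 * Real.pi) → g x = 0)
    (f : ℝ → ℂ)
    (hf : ∀ x : ℝ, f x =
      (1 / (2 * Real.pi) : ℂ) * ∫ t : ℝ, g t * Complex.exp (-Complex.I * x * t)) :
    Dense (Submodule.span ℂ
        {h : C(ℝ, ℂ) | ∃ n : ℤ, ∀ x : ℝ, h x = f (x - n)} : Set C(ℝ, ℂ)) := by
  have hfc : Continuous f := by
    rw [show f = _ from funext hf]
    refine continuous_const.mul ?_
    refine MeasureTheory.continuous_of_dominated (bound := fun t => ‖g t‖) ?_ ?_ hg.norm ?_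
    · intro x
      exact hg.aestronglyMeasurable.mul (by fun_prop)
    · intro x
      refine Filter.Eventually.of_forall fun t => ?_
      have : -Complex.I * (x : ℂ) * t = ((-(x * t) : ℝ) : ℂ) * Complex.I := by push_cast; ring
      rw [norm_mul, this, Complex.norm_exp_ofReal_mul_I, mul_one]
    · exact Filter.Eventually.of_forall fun t => by fun_prop
  intro p
  set S := Submodule.span ℂ {h : C(ℝ, ℂ) | ∃ n : ℤ, ∀ x : ℝ, h x = f (x - n)} with hS
  rw [UniformSpace.mem_closure_iff_ball]
  intro V hV
  obtain ⟨K, W, hK, hW, hKW⟩ := (ContinuousMap.mem_compactConvergence_entourage_iff V).1 hV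
  obtain ⟨ε, hε, hεW⟩ := Metric.mem_uniformity_dist.1 hW
  haveI : CompactSpace K := isCompact_iff_compactSpace.1 hK
  let res : C(ℝ, ℂ) →ₐ[ℂ] C(K, ℂ) :=
    ContinuousMap.compRightAlgHom ℂ ℂ (⟨Subtype.val, continuous_subtype_val⟩ : C(K, ℝ))
  have hres : ∀ (q : C(ℝ, ℂ)) (x : K), res q x = q x := fun q x => rfl
  have hcl := ITD.hahn_banach (S.map res.toLinearMap) (fun L hL => by
    refine ITD.compact_case g hg hg0 a hsupp f hf K L ?_
    intro n q hq
    apply hL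
    refine ⟨⟨fun x => f (x - n), by fun_prop⟩, Submodule.subset_span ⟨n, fun x => rfl⟩, ?_⟩
    ext x
    exact (hq x).symm) (res p)
  obtain ⟨_, ⟨q, hq, rfl⟩, hd⟩ := Metric.mem_closure_iff.1 hcl ε hε
  refine ⟨q, hKW fun x hx => hεW ?_, hq⟩
  exact lt_of_le_of_lt (ContinuousMap.dist_apply_le_dist (f := res p) (g := res q) (⟨x, hx⟩ : K)) hd
end

section
/- If g is a continuous function on ℝⁿ that is also integrable (g ∈ C(ℝⁿ) ∩ L¹(ℝⁿ)) and g ≠ 0, then the linear span of the translates g(· − a), a ∈ ℝⁿ, is dense in C(ℝⁿ) in the topology of uniform convergence on compact subsets. -/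
open MeasureTheory Filter Topology FourierTransform

namespace TD

variable {E : Type*} [NormedAddCommGroup E] [InnerProductSpace ℝ E] [FiniteDimensional ℝ E]
  [MeasurableSpace E] [BorelSpace E]

/-- a closed subspace contains Bochner integrals -/
lemma integral_mem_closed {F α : Type*} [NormedAddCommGroup F] [NormedSpace ℂ F] [CompleteSpace F]
    [MeasurableSpace α] {μ : Measure α} (W : Submodule ℂ F) (hW : IsClosed (W : Set F))
    (f : α → F) (hf : Integrable f μ) (h : ∀ x, f x ∈ W) : ∫ x, f x ∂μ ∈ W := by
  have : IsClosed (W : Set F) := hW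
  have h1 := (W.mkQL).integral_comp_comm hf
  have h2 : ∀ x, W.mkQL (f x) = 0 := fun x => by
    simpa using h x
  simp only [h2, integral_zero] at h1
  have := h1.symm
  simpa using this

/-- the exponential with frequency `ξ` -/
noncomputable def ex (K : Set E) (ξ : E) : C(K, ℂ) :=
  ⟨fun x => Complex.exp (2 * Real.pi * Complex.I * (inner ℝ ξ (x : E) : ℝ)), by fun_prop⟩

/-- the cutoff -/
noncomputable def cut (k : ℕ) (z : E) : ℝ := max 0 (min 1 (k + 1 - ‖z‖))

lemma cut_cont (k : ℕ) : Continuous (cut k : E → ℝ) := by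
  unfold cut; fun_prop

lemma cut_supp (k : ℕ) : HasCompactSupport (cut k : E → ℝ) := by
  have : ProperSpace E := FiniteDimensional.proper ℝ E
  refine HasCompactSupport.intro (isCompact_closedBall (0 : E) (k + 1)) fun x hx => ?_
  simp only [Metric.mem_closedBall, dist_zero_right, not_le] at hx
  unfold cut
  apply max_eq_left
  exact (min_le_right _ _).trans (by linarith)

lemma cut_one (k : ℕ) (z : E) (hz : ‖z‖ ≤ k) : cut k z = 1 := by
  unfold cut
  rw [min_eq_left (by linarith)]; simp

lemma cut_sub (k : ℕ) (z : E) : |cut k z - 1| ≤ 1 := by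
  unfold cut
  rw [abs_le]
  constructor
  · linarith [le_max_left 0 (min 1 ((k:ℝ) + 1 - ‖z‖))]
  · have : max 0 (min 1 ((k:ℝ) + 1 - ‖z‖)) ≤ 1 := max_le zero_le_one (min_le_left _ _)
    linarith

/-- translates as a continuous map to `C(K)` -/
noncomputable def tr (K : Set E) (g : E → ℂ) (hg : Continuous g) : C(E, C(K, ℂ)) :=
  ContinuousMap.curry ⟨fun p : E × K => g (p.2 - p.1), by fun_prop⟩

lemma ex_mem (K : Set E) [CompactSpace K] (g : E → ℂ) (hg : Continuous g) (hgi : Integrable g)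
    (W : Submodule ℂ C(K, ℂ)) (hW : IsClosed (W : Set C(K, ℂ))) (hT : ∀ a, tr K g hg a ∈ W)
    (ξ : E) (hξ : 𝓕 g ξ ≠ 0) : ex K ξ ∈ W := by
  obtain ⟨R, hR⟩ : ∃ R : ℝ, ∀ x : K, ‖(x : E)‖ ≤ R := by
    obtain ⟨R, hR⟩ := (isCompact_iff_compactSpace.2 ‹CompactSpace K›).isBounded.exists_norm_le
    exact ⟨R, fun x => hR _ x.2⟩
  let e : E → ℂ := fun y => Complex.exp (2 * Real.pi * Complex.I * (inner ℝ ξ y : ℝ))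
  have hec : Continuous e := by unfold e; fun_prop
  have hen : ∀ y, ‖e y‖ = 1 := fun y => by
    have : e y = Complex.exp ((2 * Real.pi * (inner ℝ ξ y : ℝ) : ℝ) * Complex.I) := by
      simp only [e]; congr 1; push_cast; ring
    rw [this, Complex.norm_exp_ofReal_mul_I]
  let Φ : ℕ → E → C(K, ℂ) := fun k y => ((cut k y : ℂ) * e y) • tr K g hg y
  have hΦi : ∀ k, Integrable (Φ k) := fun k => by
    apply Continuous.integrable_of_hasCompactSupport
    · exact ((Complex.continuous_ofReal.comp (cut_cont k)).mul hec).smul (tr K g hg).continuous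
    · refine (cut_supp (E := E) k).mono fun y hy => ?_
      contrapose! hy
      simp only [Function.mem_support, not_not] at hy
      simp [Φ, hy]
  have hΦW : ∀ k, ∫ y, Φ k y ∈ W := fun k =>
    integral_mem_closed W hW _ (hΦi k) fun y => W.smul_mem _ (hT y)
  let b : ℕ → E → ℝ := fun k => Set.indicator {y | (k : ℝ) ≤ R + ‖y‖} fun y => ‖g y‖
  have hms : ∀ k : ℕ, MeasurableSet {y : E | (k : ℝ) ≤ R + ‖y‖} := fun k =>
    (isClosed_le (by fun_prop) (by fun_prop)).measurableSet
  have hbi : ∀ k, Integrable (b k) := fun k => hgi.norm.indicator (hms k)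
  have hb0 : Tendsto (fun k => ∫ y, b k y) atTop (𝓝 0) := by
    have : (0 : ℝ) = ∫ _ : E, (0 : ℝ) := by simp
    rw [this]
    refine tendsto_integral_of_dominated_convergence (fun y => ‖g y‖)
      (fun k => (hbi k).aestronglyMeasurable) hgi.norm (fun k => ae_of_all _ fun y => ?_)
      (ae_of_all _ fun y => ?_)
    · exact (norm_indicator_le_norm_self _ _).trans (by simp)
    · obtain ⟨N, hN⟩ := exists_nat_gt (R + ‖y‖)
      refine tendsto_const_nhds.congr' ?_
      filter_upwards [eventually_ge_atTop N] with k hk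
      have : (N : ℝ) ≤ k := by exact_mod_cast hk
      symm
      apply Set.indicator_of_notMem
      simp only [Set.mem_ofPred_eq, not_le]
      linarith
  have hF : 𝓕 g ξ = ∫ y, e (-y) * g y := by
    rw [Real.fourier_eq']
    congr 1; ext y
    simp only [e, smul_eq_mul]
    congr 2
    rw [inner_neg_right, real_inner_comm]; push_cast; ring
  have hi2 : Integrable fun y => e (-y) * g y :=
    hgi.bdd_mul (c := 1) (by fun_prop) (ae_of_all _ fun y => (hen _).le)
  have hest : ∀ k, ‖(∫ y, Φ k y) - 𝓕 g ξ • ex K ξ‖ ≤ ∫ y, b k y := fun k => by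
    rw [ContinuousMap.norm_le _ (integral_nonneg fun y =>
      Set.indicator_nonneg (fun _ _ => norm_nonneg _) _)]
    intro x
    have h1 : (∫ y, Φ k y) x = ∫ y, (cut k y : ℂ) * e y * g (x - y) :=
      ((ContinuousMap.evalCLM ℂ x).integral_comp_comm (hΦi k)).symm
    have hJnt : Integrable fun y => (cut k y : ℂ) * e y * g (x - y) :=
      (ContinuousMap.evalCLM ℂ x).integrable_comp (hΦi k)
    have hJnt' : Integrable fun y => (cut k ((x : E) - y) : ℂ) * e (x - y) * g y := by
      simpa using hJnt.comp_sub_left (x : E)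
    have h2 : (∫ y, Φ k y) x = ∫ y, (cut k ((x : E) - y) : ℂ) * e (x - y) * g y := by
      rw [h1, ← integral_sub_left_eq_self _ volume (x : E)]
      simp
    have he : ∀ y, e (x - y) = e x * e (-y) := fun y => by
      simp only [e, ← Complex.exp_add]
      rw [sub_eq_add_neg, inner_add_right]; congr 1; push_cast; ring
    have h3 : (𝓕 g ξ • ex K ξ) x = ∫ y, e x * (e (-y) * g y) := by
      rw [integral_const_mul, ← hF, mul_comm]; rfl
    rw [ContinuousMap.sub_apply, h2, h3, ← integral_sub hJnt' (hi2.const_mul _)]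
    refine norm_integral_le_of_norm_le (hbi k) (ae_of_all _ fun y => ?_)
    have h4 : (cut k ((x : E) - y) : ℂ) * e (x - y) * g y - e x * (e (-y) * g y)
        = ((cut k ((x : E) - y) - 1 : ℝ) : ℂ) * e (x - y) * g y := by
      rw [he]; push_cast; ring
    rw [h4, norm_mul, norm_mul, hen, mul_one, Complex.norm_real, Real.norm_eq_abs]
    by_cases hy : (k : ℝ) ≤ R + ‖y‖
    · have : b k y = ‖g y‖ := Set.indicator_of_mem (s := {y : E | (k : ℝ) ≤ R + ‖y‖}) hy _
      refine le_of_le_of_eq ?_ this.symm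
      exact mul_le_of_le_one_left (norm_nonneg _) (cut_sub _ _)
    · rw [cut_one k]
      · simp only [sub_self, abs_zero, zero_mul]
        exact Set.indicator_nonneg (fun _ _ => norm_nonneg _) _
      · have := norm_sub_le (x : E) y
        have := hR x
        linarith
  have hlim : Tendsto (fun k => ∫ y, Φ k y) atTop (𝓝 (𝓕 g ξ • ex K ξ)) := by
    rw [tendsto_iff_norm_sub_tendsto_zero]
    exact squeeze_zero (fun _ => norm_nonneg _) hest hb0
  have hm : 𝓕 g ξ • ex K ξ ∈ W := hW.mem_of_tendsto hlim (Eventually.of_forall hΦW)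
  exact (W.smul_mem_iff hξ).1 hm

lemma ex_add (K : Set E) (ξ η : E) : ex K (ξ + η) = ex K ξ * ex K η := by
  ext x
  simp only [ex, ContinuousMap.coe_mk, ContinuousMap.mul_apply, ← Complex.exp_add, inner_add_left]
  congr 1; push_cast; ring

lemma ex_smul_analytic (K : Set E) [CompactSpace K] (η : E) (t : ℝ) :
    AnalyticAt ℝ (fun t : ℝ => ex K (t • η)) t := by
  let f : C(K, ℂ) := ⟨fun x => 2 * Real.pi * Complex.I * (inner ℝ η (x : E) : ℝ), by fun_prop⟩
  have h : (fun t : ℝ => ex K (t • η)) = fun t : ℝ => NormedSpace.exp (t • f) := by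
    ext t x
    have := NormedSpace.map_exp (ContinuousMap.evalAlgHom ℂ ℂ x)
      (continuous_eval_const x) (t • f)
    change _ = ContinuousMap.evalAlgHom ℂ ℂ x (NormedSpace.exp (t • f))
    rw [this, ← Complex.exp_eq_exp_ℂ]
    simp only [ex, ContinuousMap.coe_mk, f, inner_smul_left]
    congr 1
    simp
    ring
  rw [h]
  have h1 : AnalyticAt ℝ (fun t : ℝ => t • f) t := analyticAt_id.smul analyticAt_const
  exact AnalyticAt.fun_comp (f := fun t : ℝ => t • f)
    (NormedSpace.exp_analytic (𝕂 := ℝ) (t • f)) h1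

lemma ex_all (K : Set E) [CompactSpace K] (W : Submodule ℂ C(K, ℂ))
    (hW : IsClosed (W : Set C(K, ℂ))) (ξ₀ : E) (h : ∀ᶠ ξ in 𝓝 ξ₀, ex K ξ ∈ W) (ξ : E) :
    ex K ξ ∈ W := by
  have : IsClosed (W : Set C(K, ℂ)) := hW
  let L : C(K, ℂ) →L[ℝ] (C(K, ℂ) ⧸ W) := (W.mkQL).restrictScalars ℝ
  have hL : ∀ f, L f = 0 ↔ f ∈ W := fun f => by simp [L]
  let p : ℝ → C(K, ℂ) ⧸ W := fun t => L (ex K (ξ₀ + t • (ξ - ξ₀)))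
  have hp : AnalyticOnNhd ℝ p Set.univ := fun t _ => by
    have h1 : AnalyticAt ℝ (fun t : ℝ => ex K ξ₀ * ex K (t • (ξ - ξ₀))) t :=
      analyticAt_const.mul (ex_smul_analytic K _ t)
    simp only [← ex_add] at h1
    exact (L.analyticAt _).fun_comp h1
  have h0 : p =ᶠ[𝓝 0] 0 := by
    have hc : Tendsto (fun t : ℝ => ξ₀ + t • (ξ - ξ₀)) (𝓝 0) (𝓝 ξ₀) := by
      have : Continuous (fun t : ℝ => ξ₀ + t • (ξ - ξ₀)) := by fun_prop
      simpa using this.tendsto 0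
    filter_upwards [hc.eventually h] with t ht
    exact (hL _).2 ht
  have := hp.eqOn_zero_of_preconnected_of_eventuallyEq_zero isPreconnected_univ
    (Set.mem_univ 0) h0 (Set.mem_univ 1)
  have := (hL _).1 this
  simpa using this

lemma top_of_ex (K : Set E) [CompactSpace K] (W : Submodule ℂ C(K, ℂ))
    (hW : IsClosed (W : Set C(K, ℂ))) (h : ∀ ξ, ex K ξ ∈ W) (f : C(K, ℂ)) : f ∈ W := by
  let M : Submonoid C(K, ℂ) :=
    { carrier := Set.range (ex K)
      one_mem' := ⟨0, by ext x; simp [ex]⟩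
      mul_mem' := by
        rintro _ _ ⟨a, rfl⟩ ⟨b, rfl⟩
        exact ⟨a + b, ex_add K a b⟩ }
  have hstar : ∀ ξ, star (ex K ξ) = ex K (-ξ) := fun ξ => by
    ext x
    simp [ex, ← Complex.exp_conj, Complex.conj_ofNat]
  let A : StarSubalgebra ℂ C(K, ℂ) :=
    { Algebra.adjoin ℂ (M : Set C(K, ℂ)) with
      star_mem' := by
        intro a ha
        change a ∈ Algebra.adjoin ℂ (M : Set C(K, ℂ)) at ha
        change star a ∈ Algebra.adjoin ℂ (M : Set C(K, ℂ))
        induction ha using Algebra.adjoin_induction with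
        | mem x hx =>
          obtain ⟨ξ, rfl⟩ := hx
          rw [hstar]
          exact Algebra.subset_adjoin ⟨-ξ, rfl⟩
        | algebraMap r =>
          rw [← algebraMap_star_comm]
          exact Subalgebra.algebraMap_mem _ _
        | add x y _ _ hx hy => rw [star_add]; exact add_mem hx hy
        | mul x y _ _ hx hy => rw [star_mul]; exact mul_mem hy hx }
  have hAM : ∀ a ∈ A, a ∈ W := by
    intro a ha
    have ha : a ∈ Subalgebra.toSubmodule (Algebra.adjoin ℂ (M : Set C(K, ℂ))) := ha
    rw [Algebra.adjoin_eq_span, Submonoid.closure_eq] at ha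
    refine Submodule.span_le.2 ?_ ha
    rintro _ ⟨ξ, rfl⟩
    exact h ξ
  have hsep : A.SeparatesPoints := by
    intro x y hxy
    by_contra! hcon
    have hall : ∀ ξ, ex K ξ x = ex K ξ y := fun ξ =>
      hcon _ ⟨ex K ξ, Algebra.subset_adjoin ⟨ξ, rfl⟩, rfl⟩
    have hd : (x : E) - y ≠ 0 := sub_ne_zero.2 fun h => hxy (Subtype.ext h)
    let d : E := (x : E) - y
    have hdn : (inner ℝ d d : ℝ) ≠ 0 := inner_self_ne_zero.2 hd
    have h1 := hall ((1 / (2 * inner ℝ d d) : ℝ) • d)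
    simp only [ex, ContinuousMap.coe_mk] at h1
    have hx : (x : E) = y + d := by simp [d]
    rw [hx, inner_add_right, inner_smul_left _ d] at h1
    have h2 : (starRingEnd ℝ) (1 / (2 * inner ℝ d d) : ℝ) * inner ℝ d d = 1 / 2 := by
      simp only [conj_trivial]; field_simp
    rw [h2, Complex.ofReal_add, mul_add, Complex.exp_add] at h1
    have h3 : (2 * Real.pi * Complex.I * ((1 / 2 : ℝ) : ℂ)) = Real.pi * Complex.I := by
      push_cast; ring
    rw [h3, Complex.exp_pi_mul_I] at h1
    have h4 := Complex.exp_ne_zero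
      (2 * Real.pi * Complex.I * (inner ℝ ((1 / (2 * inner ℝ d d) : ℝ) • d) (y : E) : ℝ))
    apply h4
    linear_combination (-1 / 2 : ℂ) * h1
  have htop := ContinuousMap.starSubalgebra_topologicalClosure_eq_top_of_separatesPoints A hsep
  have hf : f ∈ A.topologicalClosure := by rw [htop]; trivial
  have hf' : f ∈ closure (A : Set C(K, ℂ)) := hf
  exact closure_minimal hAM hW hf'

lemma exists_fourier_ne (g : E → ℂ) (hgc : Continuous g) (hgi : Integrable g) (hg0 : g ≠ 0) :
    ∃ ξ, 𝓕 g ξ ≠ 0 := by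
  by_contra! h
  have h0 : 𝓕 g = 0 := funext h
  have hi : Integrable (𝓕 g) := by rw [h0]; exact integrable_zero _ _ _
  apply hg0
  rw [← hgc.fourierInv_fourier_eq hgi hi, h0]
  ext v
  simp [Real.fourierInv_eq]

lemma fourier_cont (g : E → ℂ) (hgi : Integrable g) : Continuous (𝓕 g) :=
  VectorFourier.fourierIntegral_continuous Real.continuous_fourierChar
    (L := innerₗ E) continuous_inner hgi

lemma dense_on (K : Set E) [CompactSpace K] (g : E → ℂ) (hg : Continuous g) (hgi : Integrable g)
    (hg0 : g ≠ 0) (W : Submodule ℂ C(K, ℂ)) (hW : IsClosed (W : Set C(K, ℂ)))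
    (hT : ∀ a, tr K g hg a ∈ W) (f : C(K, ℂ)) : f ∈ W := by
  obtain ⟨ξ₀, h0⟩ := exists_fourier_ne g hg hgi hg0
  refine top_of_ex K W hW (ex_all K W hW ξ₀ ?_) f
  filter_upwards [(fourier_cont g hgi).continuousAt.eventually_ne h0] with ξ hξ
  exact ex_mem K g hg hgi W hW hT ξ hξ

end TD

/-- If g ∈ C(ℝⁿ) ∩ L¹(ℝⁿ) and g ≠ 0, then the span of the translates g(· - a), a ∈ ℝⁿ,
is dense in C(ℝⁿ) in the topology of uniform convergence on compacta. -/
theorem translates_dense (n : ℕ) (g : EuclideanSpace ℝ (Fin n) → ℂ)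
    (hgc : Continuous g) (hgi : MeasureTheory.Integrable g) (hg0 : g ≠ 0) :
    Dense (Submodule.span ℂ
        {h : C(EuclideanSpace ℝ (Fin n), ℂ) |
          ∃ a : EuclideanSpace ℝ (Fin n), ∀ x, h x = g (x - a)} :
        Set C(EuclideanSpace ℝ (Fin n), ℂ)) := by
  intro f
  set S := Submodule.span ℂ
        {h : C(EuclideanSpace ℝ (Fin n), ℂ) |
          ∃ a : EuclideanSpace ℝ (Fin n), ∀ x, h x = g (x - a)} with hS
  rw [mem_closure_iff_nhds_basis
    (nhds_basis_uniformity' (Metric.uniformity_basis_dist.compactConvergenceUniformity))]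
  rintro ⟨K, ε⟩ ⟨hK, hε⟩
  have : CompactSpace K := isCompact_iff_compactSpace.1 hK
  let r : C(EuclideanSpace ℝ (Fin n), ℂ) →ₗ[ℂ] C(K, ℂ) :=
    { toFun := fun h => h.restrict K
      map_add' := fun _ _ => rfl
      map_smul' := fun _ _ => rfl }
  have hmem := TD.dense_on K g hgc hgi hg0 (S.map r).topologicalClosure
    (Submodule.isClosed_topologicalClosure _) (fun a => by
      apply Submodule.le_topologicalClosure
      refine ⟨⟨fun x => g (x - a), by fun_prop⟩, Submodule.subset_span ⟨a, fun x => rfl⟩, ?_⟩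
      ext x
      rfl) (r f)
  have hmem' : r f ∈ closure (S.map r : Set C(K, ℂ)) := hmem
  obtain ⟨_, ⟨h, hh, rfl⟩, hd⟩ := Metric.mem_closure_iff.1 hmem' ε hε
  refine ⟨h, hh, fun x hx => ?_⟩
  exact (ContinuousMap.dist_apply_le_dist (f := r f) (g := r h) ⟨x, hx⟩).trans_lt hd
end
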